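/- arXiv:1210.3311 — 2 statements merged into one kernel-verified Lean document; each statement's English description precedes it below -/
import Mathlib

section
/- If ω is a radial continuous weight on the unit disc that is either regular or rapidly increasing, then ∫_0^1 s^x ω(s) ds ≍ ∫_{1−1/x}^1 ω(s) ds for all x ∈ [1,∞), with constants of comparison independent of x. -/
open MeasureTheory Set Filter

noncomputable section

/-- `wInt ω r = ∫_r^1 ω(s) ds`. -/
def wInt (ω : ℝ → ℝ) (r : ℝ) : ℝ := ∫ s in r..1, ω s

/-- A radial weight on the unit disc, identified with a function on `[0,1)`:
positive and integrable. -/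
def IsRadialWeight (ω : ℝ → ℝ) : Prop :=
  (∀ r ∈ Set.Ico (0:ℝ) 1, 0 < ω r) ∧ IntegrableOn ω (Set.Ico (0:ℝ) 1)

/-- A radial continuous weight. -/
def IsRadialContinuousWeight (ω : ℝ → ℝ) : Prop :=
  IsRadialWeight ω ∧ ContinuousOn ω (Set.Ico (0:ℝ) 1)

/-- A regular weight: radial continuous with `ψ_ω(r) ≍ 1 - r`, i.e.
`(1-r)·ω(r) ≍ ∫_r^1 ω(s) ds` on `[0,1)`. -/
def IsRegularWeight (ω : ℝ → ℝ) : Prop :=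
  IsRadialContinuousWeight ω ∧ ∃ c C : ℝ, 0 < c ∧ 0 < C ∧
    ∀ r ∈ Set.Ico (0:ℝ) 1,
      c * ((1 - r) * ω r) ≤ wInt ω r ∧ wInt ω r ≤ C * ((1 - r) * ω r)

/-- A rapidly increasing weight: radial continuous with
`ψ_ω(r)/(1-r) = (∫_r^1 ω)/(ω(r)(1-r)) → ∞` as `r → 1⁻`. -/
def IsRapidlyIncreasing (ω : ℝ → ℝ) : Prop :=
  IsRadialContinuousWeight ω ∧
    Tendsto (fun r => wInt ω r / (ω r * (1 - r))) (nhdsWithin 1 (Set.Iio 1)) atTop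

namespace IsRadialContinuousWeight

variable {ω : ℝ → ℝ}

lemma intervalIntegrable (h : IsRadialContinuousWeight ω) {a b : ℝ}
    (ha : a ∈ Icc (0:ℝ) 1) (hb : b ∈ Icc (0:ℝ) 1) : IntervalIntegrable ω volume a b := by
  have h01 : IntervalIntegrable ω volume 0 1 :=
    (intervalIntegrable_iff_integrableOn_Ico_of_le zero_le_one).2 h.1.2
  refine h01.mono_set ?_
  rw [uIcc_of_le zero_le_one]
  exact uIcc_subset_Icc ha hb

lemma rpow_mul_intervalIntegrable (h : IsRadialContinuousWeight ω) {a b x : ℝ}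
    (ha : a ∈ Icc (0:ℝ) 1) (hb : b ∈ Icc (0:ℝ) 1) (hx : 0 ≤ x) :
    IntervalIntegrable (fun s => s ^ x * ω s) volume a b :=
  (h.intervalIntegrable ha hb).continuousOn_mul
    (Real.continuous_rpow_const hx).continuousOn

lemma wInt_add (h : IsRadialContinuousWeight ω) {a b : ℝ}
    (ha : a ∈ Icc (0:ℝ) 1) (hb : b ∈ Icc (0:ℝ) 1) :
    (∫ s in a..b, ω s) + wInt ω b = wInt ω a :=
  intervalIntegral.integral_add_adjacent_intervals (h.intervalIntegrable ha hb)
    (h.intervalIntegrable hb ⟨zero_le_one, le_rfl⟩)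

lemma wInt_anti (h : IsRadialContinuousWeight ω) {a b : ℝ}
    (ha : 0 ≤ a) (hab : a ≤ b) (hb : b < 1) : wInt ω b ≤ wInt ω a := by
  rw [← h.wInt_add ⟨ha, hab.trans hb.le⟩ ⟨ha.trans hab, hb.le⟩]
  have : 0 ≤ ∫ s in a..b, ω s := intervalIntegral.integral_nonneg hab fun s hs =>
    (h.1.1 s ⟨ha.trans hs.1, hs.2.trans_lt hb⟩).le
  linarith

lemma wInt_pos (h : IsRadialContinuousWeight ω) {r : ℝ} (hr : r ∈ Ico (0:ℝ) 1) :
    0 < wInt ω r :=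
  intervalIntegral.intervalIntegral_pos_of_pos_on
    (h.intervalIntegrable ⟨hr.1, hr.2.le⟩ ⟨zero_le_one, le_rfl⟩)
    (fun s hs => h.1.1 s ⟨hr.1.trans hs.1.le, hs.2⟩) hr.2

lemma hasDerivAt_wInt (h : IsRadialContinuousWeight ω) {r : ℝ} (hr : r ∈ Ioo (0:ℝ) 1) :
    HasDerivAt (wInt ω) (-ω r) r := by
  have hc : ContinuousOn ω (Ioo 0 1) := h.2.mono Ioo_subset_Ico_self
  exact intervalIntegral.integral_hasDerivAt_left
    (h.intervalIntegrable ⟨hr.1.le, hr.2.le⟩ ⟨zero_le_one, le_rfl⟩)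
    (hc.stronglyMeasurableAtFilter isOpen_Ioo r hr)
    (hc.continuousAt (isOpen_Ioo.mem_nhds hr))

lemma continuousOn_wInt (h : IsRadialContinuousWeight ω) :
    ContinuousOn (wInt ω) (Icc 0 1) := by
  have hi : IntegrableOn ω (uIcc 0 1) := by
    rw [uIcc_of_le zero_le_one]
    exact (integrableOn_Icc_iff_integrableOn_Ico).2 h.1.2
  have := intervalIntegral.continuousOn_primitive_interval_left hi
  rwa [uIcc_of_le zero_le_one] at this

/-- A one-sided bound on the distortion function gives polynomial growth of the tail integral. -/
lemma monotoneOn_wInt_div_pow (h : IsRadialContinuousWeight ω) {n : ℕ}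
    (hn : ∀ r ∈ Ico (0:ℝ) 1, (1 - r) * ω r ≤ n * wInt ω r) :
    MonotoneOn (fun r => wInt ω r / (1 - r) ^ n) (Ico 0 1) := by
  have hd : ∀ r ∈ Ioo (0:ℝ) 1, HasDerivAt (fun r => wInt ω r / (1 - r) ^ n)
      ((-ω r * (1 - r) ^ n - wInt ω r * (n * (1 - r) ^ (n - 1) * -1)) / ((1 - r) ^ n) ^ 2) r := by
    intro r hr
    have h1 : HasDerivAt (fun r : ℝ => (1 - r) ^ n) (n * (1 - r) ^ (n - 1) * -1) r :=
      ((hasDerivAt_id r).const_sub 1).pow n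
    exact (h.hasDerivAt_wInt hr).div h1 (pow_ne_zero _ (sub_pos.2 hr.2).ne')
  refine monotoneOn_of_deriv_nonneg (convex_Ico 0 1) ?_ ?_ ?_
  · refine (h.continuousOn_wInt.mono Ico_subset_Icc_self).div (by fun_prop) fun r hr => ?_
    exact pow_ne_zero _ (sub_pos.2 hr.2).ne'
  · rw [interior_Ico]
    exact fun r hr => (hd r hr).differentiableAt.differentiableWithinAt
  · rw [interior_Ico]
    intro r hr
    rw [(hd r hr).deriv]
    refine div_nonneg ?_ (by positivity)
    have hr' := hn r ⟨hr.1.le, hr.2⟩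
    have h1 : 0 < 1 - r := sub_pos.2 hr.2
    rcases n with _ | m
    · have := h.1.1 r ⟨hr.1.le, hr.2⟩
      have := mul_pos h1 this
      simp at hr'
      linarith
    · have := mul_le_mul_of_nonneg_left hr' (pow_pos h1 m).le
      simp only [Nat.add_sub_cancel, pow_succ]
      linarith

lemma wInt_le_pow_mul (h : IsRadialContinuousWeight ω) {n : ℕ}
    (hn : ∀ r ∈ Ico (0:ℝ) 1, (1 - r) * ω r ≤ n * wInt ω r) {r t : ℝ}
    (hr : 0 ≤ r) (hrt : r ≤ t) (ht : t < 1) :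
    wInt ω r ≤ ((1 - r) / (1 - t)) ^ n * wInt ω t := by
  have h1 := h.monotoneOn_wInt_div_pow hn ⟨hr, hrt.trans_lt ht⟩ ⟨hr.trans hrt, ht⟩ hrt
  have hr1 : 0 < (1 - r) ^ n := pow_pos (by linarith) n
  simp only [div_le_iff₀ hr1] at h1
  calc wInt ω r ≤ wInt ω t / (1 - t) ^ n * (1 - r) ^ n := h1
    _ = _ := by rw [div_pow]; ring

lemma rpow_mul_le (h : IsRadialContinuousWeight ω) {n : ℕ}
    (hn : ∀ r ∈ Ico (0:ℝ) 1, (1 - r) * ω r ≤ n * wInt ω r) {x s : ℝ} (hx : 1 ≤ x)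
    (hs : s ∈ Icc 0 (1 - 1 / x)) :
    s ^ x * ω s ≤ n * 2 ^ n * n.factorial * wInt ω (1 - 1 / x) *
      (x * Real.exp (x / 2 * s - x / 2)) := by
  have hx0 : 0 < x := by linarith
  have ht1 : 1 - 1 / x < 1 := by have : 0 < 1 / x := by positivity
                                 linarith
  have hs1 : s < 1 := hs.2.trans_lt ht1
  have hω := h.1.1 s ⟨hs.1, hs1⟩
  have hW := h.wInt_pos ⟨hs.1.trans hs.2, ht1⟩
  set W := wInt ω (1 - 1 / x)
  have hu : 1 ≤ x * (1 - s) := by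
    have h2 : 1 / x ≤ 1 - s := by linarith [hs.2]
    rw [div_le_iff₀ hx0] at h2
    linarith
  have hωle : ω s ≤ x * (n * ((x * (1 - s)) ^ n * W)) := by
    have h3 := h.wInt_le_pow_mul hn hs.1 hs.2 ht1
    have h4 : (1 - s) / (1 - (1 - 1 / x)) = x * (1 - s) := by field_simp; ring
    rw [h4] at h3
    calc ω s ≤ (x * (1 - s)) * ω s := le_mul_of_one_le_left hω.le hu
      _ = x * ((1 - s) * ω s) := by ring
      _ ≤ x * (n * wInt ω s) := mul_le_mul_of_nonneg_left (hn s ⟨hs.1, hs1⟩) hx0.le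
      _ ≤ _ := by gcongr
  have hpow : s ^ x ≤ Real.exp (-(x * (1 - s))) := by
    have h5 : s ≤ Real.exp (-(1 - s)) := by
      have := Real.add_one_le_exp (-(1 - s)); linarith
    calc s ^ x ≤ Real.exp (-(1 - s)) ^ x := Real.rpow_le_rpow hs.1 h5 hx0.le
      _ = _ := by rw [← Real.exp_mul]; ring_nf
  have hfac : (x * (1 - s)) ^ n ≤ 2 ^ n * n.factorial * Real.exp (x * (1 - s) / 2) := by
    have h6 := Real.pow_div_factorial_le_exp (x * (1 - s) / 2) (by linarith) n
    have hf : (0:ℝ) < n.factorial := by exact_mod_cast n.factorial_pos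
    rw [div_le_iff₀ hf, div_pow, div_le_iff₀ (by positivity)] at h6
    linarith
  calc s ^ x * ω s
      ≤ Real.exp (-(x * (1 - s))) *
        (x * (n * ((2 ^ n * n.factorial * Real.exp (x * (1 - s) / 2)) * W))) := by
        refine mul_le_mul hpow (hωle.trans ?_) hω.le (Real.exp_pos _).le
        gcongr
    _ = n * 2 ^ n * n.factorial * W *
        (x * (Real.exp (-(x * (1 - s))) * Real.exp (x * (1 - s) / 2))) := by ring
    _ = _ := by rw [← Real.exp_add]; ring_nf

/-- A one-sided bound on the distortion function makes moments comparable to tail integrals. -/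
lemma moment_bounds (h : IsRadialContinuousWeight ω) {n : ℕ}
    (hn : ∀ r ∈ Ico (0:ℝ) 1, (1 - r) * ω r ≤ n * wInt ω r) {x : ℝ} (hx : 1 ≤ x) :
    1 / 2 ^ (n + 1) * wInt ω (1 - 1 / x) ≤ (∫ s in (0:ℝ)..1, s ^ x * ω s) ∧
      (∫ s in (0:ℝ)..1, s ^ x * ω s) ≤
        (n * 2 ^ n * n.factorial * 2 + 1) * wInt ω (1 - 1 / x) := by
  have hx0 : 0 < x := by linarith
  have hix : 0 < 1 / x := by positivity
  have hix1 : 1 / x ≤ 1 := by rw [div_le_one hx0]; exact hx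
  have hnn : ∀ s ∈ Icc (0:ℝ) 1, s ≠ 1 → 0 ≤ s ^ x * ω s := fun s hs hs1 =>
    mul_nonneg (Real.rpow_nonneg hs.1 x) (h.1.1 s ⟨hs.1, lt_of_le_of_ne hs.2 hs1⟩).le
  have split : ∀ t ∈ Icc (0:ℝ) 1, (∫ s in (0:ℝ)..t, s ^ x * ω s) + (∫ s in t..1, s ^ x * ω s) =
      ∫ s in (0:ℝ)..1, s ^ x * ω s := fun t ht =>
    intervalIntegral.integral_add_adjacent_intervals
      (h.rpow_mul_intervalIntegrable ⟨le_rfl, zero_le_one⟩ ht hx0.le)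
      (h.rpow_mul_intervalIntegrable ht ⟨zero_le_one, le_rfl⟩ hx0.le)
  constructor
  · set q := 1 - 1 / x / 2 with hq
    have hqmem : q ∈ Ico (0:ℝ) 1 := ⟨by linarith, by linarith⟩
    have hdoubling : wInt ω (1 - 1 / x) ≤ 2 ^ n * wInt ω q := by
      have := h.wInt_le_pow_mul hn (r := 1 - 1 / x) (t := q) (by linarith) (by linarith) hqmem.2
      have h2 : (1 - (1 - 1 / x)) / (1 - q) = 2 := by rw [hq]; field_simp; ring
      rwa [h2] at this
    have hqx : 1 / 2 ≤ q ^ x := by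
      have := one_add_mul_self_le_rpow_one_add (s := -(1 / x / 2)) (by linarith) hx
      have h3 : 1 + x * -(1 / x / 2) = 1 / 2 := by field_simp; ring
      rw [h3] at this
      exact this
    have hleft : 0 ≤ ∫ s in (0:ℝ)..q, s ^ x * ω s :=
      intervalIntegral.integral_nonneg hqmem.1 fun s hs =>
        hnn s ⟨hs.1, hs.2.trans hqmem.2.le⟩ (hs.2.trans_lt hqmem.2).ne
    have hright : 1 / 2 * wInt ω q ≤ ∫ s in q..1, s ^ x * ω s := by
      rw [wInt, ← intervalIntegral.integral_const_mul]
      refine intervalIntegral.integral_mono_on_of_le_Ioo hqmem.2.le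
        ((h.intervalIntegrable ⟨hqmem.1, hqmem.2.le⟩ ⟨zero_le_one, le_rfl⟩).const_mul _)
        (h.rpow_mul_intervalIntegrable ⟨hqmem.1, hqmem.2.le⟩ ⟨zero_le_one, le_rfl⟩ hx0.le)
        fun s hs => ?_
      exact mul_le_mul_of_nonneg_right
        (hqx.trans (Real.rpow_le_rpow hqmem.1 hs.1.le hx0.le))
        (h.1.1 s ⟨hqmem.1.trans hs.1.le, hs.2⟩).le
    rw [← split q ⟨hqmem.1, hqmem.2.le⟩]
    calc 1 / 2 ^ (n + 1) * wInt ω (1 - 1 / x)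
        ≤ 1 / 2 ^ (n + 1) * (2 ^ n * wInt ω q) := by gcongr
      _ = 1 / 2 * wInt ω q := by rw [pow_succ]; field_simp
      _ ≤ _ := by linarith
  · set t := 1 - 1 / x with ht
    have htmem : t ∈ Ico (0:ℝ) 1 := ⟨by linarith, by linarith⟩
    have htmem' : t ∈ Icc (0:ℝ) 1 := ⟨htmem.1, htmem.2.le⟩
    have hW := h.wInt_pos htmem
    have hright : ∫ s in t..1, s ^ x * ω s ≤ wInt ω t := by
      refine intervalIntegral.integral_mono_on_of_le_Ioo htmem.2.le
        (h.rpow_mul_intervalIntegrable htmem' ⟨zero_le_one, le_rfl⟩ hx0.le)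
        (h.intervalIntegrable htmem' ⟨zero_le_one, le_rfl⟩) fun s hs => ?_
      have hs0 : 0 ≤ s := htmem.1.trans hs.1.le
      exact mul_le_of_le_one_left (h.1.1 s ⟨hs0, hs.2⟩).le
        (Real.rpow_le_one hs0 hs.2.le hx0.le)
    have hexp : ∫ s in (0:ℝ)..t, x * Real.exp (x / 2 * s - x / 2) ≤ 2 := by
      have hd : ∀ s ∈ uIcc (0:ℝ) t, HasDerivAt (fun s => 2 * Real.exp (x / 2 * s - x / 2))
          (x * Real.exp (x / 2 * s - x / 2)) s := by
        intro s _
        have h1 : HasDerivAt (fun s : ℝ => x / 2 * s - x / 2) (x / 2 * 1) s :=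
          ((hasDerivAt_id s).const_mul (x / 2)).sub_const _
        exact (h1.exp.const_mul 2).congr_deriv (by ring)
      rw [intervalIntegral.integral_eq_sub_of_hasDerivAt hd
        ((by fun_prop : Continuous fun s => x * Real.exp (x / 2 * s - x / 2)).intervalIntegrable
          _ _)]
      have h1 : Real.exp (x / 2 * t - x / 2) ≤ 1 := by
        rw [Real.exp_le_one_iff]
        nlinarith [htmem.2]
      have h2 := Real.exp_pos (x / 2 * 0 - x / 2)
      linarith
    have hleft : ∫ s in (0:ℝ)..t, s ^ x * ω s ≤ n * 2 ^ n * n.factorial * wInt ω t * 2 := by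
      calc ∫ s in (0:ℝ)..t, s ^ x * ω s
          ≤ ∫ s in (0:ℝ)..t, n * 2 ^ n * n.factorial * wInt ω t *
              (x * Real.exp (x / 2 * s - x / 2)) :=
            intervalIntegral.integral_mono_on htmem.1
              (h.rpow_mul_intervalIntegrable ⟨le_rfl, zero_le_one⟩ htmem' hx0.le)
              (Continuous.intervalIntegrable (by fun_prop) _ _)
              fun s hs => h.rpow_mul_le hn hx hs
        _ = n * 2 ^ n * n.factorial * wInt ω t *
              ∫ s in (0:ℝ)..t, x * Real.exp (x / 2 * s - x / 2) :=
            intervalIntegral.integral_const_mul _ _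
        _ ≤ _ := by gcongr
    rw [← split t htmem']
    linarith

end IsRadialContinuousWeight

lemma IsRegularWeight.exists_nat_bound {ω : ℝ → ℝ} (h : IsRegularWeight ω) :
    ∃ n : ℕ, ∀ r ∈ Ico (0:ℝ) 1, (1 - r) * ω r ≤ n * wInt ω r := by
  obtain ⟨hω, c, _, hc, -, hb⟩ := h
  obtain ⟨n, hn⟩ := exists_nat_ge (1 / c)
  refine ⟨n, fun r hr => ?_⟩
  calc (1 - r) * ω r = 1 / c * (c * ((1 - r) * ω r)) := by field_simp
    _ ≤ 1 / c * wInt ω r := by gcongr; exact (hb r hr).1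
    _ ≤ n * wInt ω r := mul_le_mul_of_nonneg_right hn (hω.wInt_pos hr).le

lemma IsRapidlyIncreasing.exists_nat_bound {ω : ℝ → ℝ} (h : IsRapidlyIncreasing ω) :
    ∃ n : ℕ, ∀ r ∈ Ico (0:ℝ) 1, (1 - r) * ω r ≤ n * wInt ω r := by
  obtain ⟨hω, ht⟩ := h
  obtain ⟨a, ha, hab⟩ := (mem_nhdsLT_iff_exists_Ioo_subset).1 (ht.eventually_ge_atTop 1)
  set b := max a 0
  have hb : b ∈ Ico (0:ℝ) 1 := ⟨le_max_right _ _, max_lt ha zero_lt_one⟩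
  obtain ⟨M, hM⟩ := isCompact_Icc.bddAbove_image
    (hω.2.mono (fun s hs => ⟨hs.1, hs.2.trans_lt hb.2⟩ : Icc 0 b ⊆ Ico 0 1))
  have hWb := hω.wInt_pos hb
  obtain ⟨n, hn⟩ := exists_nat_ge (max 1 (M / wInt ω b))
  refine ⟨n, fun r hr => ?_⟩
  have hωr := hω.1.1 r hr
  rcases le_or_gt r b with hrb | hrb
  · calc (1 - r) * ω r ≤ ω r := mul_le_of_le_one_left hωr.le (by linarith [hr.1])
      _ ≤ M := hM (mem_image_of_mem ω ⟨hr.1, hrb⟩)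
      _ ≤ n * wInt ω b := (div_le_iff₀ hWb).1 ((le_max_right _ _).trans hn)
      _ ≤ n * wInt ω r := by gcongr; exact hω.wInt_anti hr.1 hrb hb.2
  · have h1 : 1 ≤ wInt ω r / (ω r * (1 - r)) := hab ⟨(le_max_left _ _).trans_lt hrb, hr.2⟩
    rw [one_le_div (mul_pos hωr (sub_pos.2 hr.2))] at h1
    calc (1 - r) * ω r = ω r * (1 - r) := mul_comm _ _
      _ ≤ wInt ω r := h1
      _ ≤ n * wInt ω r :=
        le_mul_of_one_le_left (hω.wInt_pos hr).le ((le_max_left _ _).trans hn)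

theorem stmt2 (ω : ℝ → ℝ) (hω : IsRegularWeight ω ∨ IsRapidlyIncreasing ω) :
    ∃ c C : ℝ, 0 < c ∧ 0 < C ∧ ∀ x : ℝ, 1 ≤ x →
      c * wInt ω (1 - 1 / x) ≤ (∫ s in (0:ℝ)..1, s ^ x * ω s) ∧
        (∫ s in (0:ℝ)..1, s ^ x * ω s) ≤ C * wInt ω (1 - 1 / x) := by
  have hc : IsRadialContinuousWeight ω := hω.elim And.left And.left
  obtain ⟨n, hn⟩ := hω.elim IsRegularWeight.exists_nat_bound IsRapidlyIncreasing.exists_nat_bound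
  exact ⟨1 / 2 ^ (n + 1), n * 2 ^ n * n.factorial * 2 + 1, by positivity, by positivity,
    fun x hx => hc.moment_bounds hn hx⟩
end
end

section
/- Let ω be a radial weight on the unit disc and let ω*(z) = ∫_{|z|}^1 ω(s) log(s/|z|) s ds. (i) ω(T(z)) ≍ ω*(z) for all |z| ≥ 1/2, where T(z) is the tent over z. (ii) If in addition ω is continuous and either regular or rapidly increasing, then ω(T(z)) ≍ ω(S(z)) for all z ∈ 𝔻, where S(z) is the Carleson square at z. Here constants of comparison are independent of z. -/
open MeasureTheory Set Filter

noncomputable section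

/-- The open unit disc in `ℂ`. -/
def unitDisc : Set ℂ := {z : ℂ | ‖z‖ < 1}

/-- The non-tangential (lens type) region `Γ(u)` with vertex at `u = re^{iθ}`:
`{z ∈ 𝔻 : |θ - arg z| < (1 - |z|/r)/2}`. -/
def Gamma (u : ℂ) : Set ℂ :=
  {z : ℂ | z ∈ unitDisc ∧ |Complex.arg u - Complex.arg z| < (1 - ‖z‖ / ‖u‖) / 2}

/-- The tent `T(z) = {u ∈ 𝔻 : z ∈ Γ(u)}`. -/
def Tent (z : ℂ) : Set ℂ := {u : ℂ | u ∈ unitDisc ∧ z ∈ Gamma u}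

/-- The Carleson square `S(a) = S(I_a)` associated with the point `a ∈ 𝔻`:
`I_a = {e^{iθ} : |arg (a e^{-iθ})| ≤ (1-|a|)/2}` and
`S(I_a) = {re^{it} : e^{it} ∈ I_a, |a| ≤ r < 1}`. -/
def CSq (a : ℂ) : Set ℂ :=
  {z : ℂ | ‖a‖ ≤ ‖z‖ ∧ ‖z‖ < 1 ∧
    |Complex.arg (a * Complex.exp (-(Complex.arg z : ℂ) * Complex.I))| ≤ (1 - ‖a‖) / 2}

/-- The Carleson square `S(I)` associated with the arc `I ⊂ 𝕋` of midpoint `e^{iθ}` and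
arc length `h`. -/
def CBox (θ h : ℝ) : Set ℂ :=
  {z : ℂ | 1 - h ≤ ‖z‖ ∧ ‖z‖ < 1 ∧
    |Complex.arg (z * Complex.exp (-(θ : ℂ) * Complex.I))| ≤ h / 2}

/-- The associated weight `ω*(z) = ∫_{|z|}^1 ω(s) log (s/|z|) s ds`. -/
def wStar (ω : ℝ → ℝ) (z : ℂ) : ℝ := ∫ s in ‖z‖..1, ω s * Real.log (s / ‖z‖) * s

/-- The length of the part of the circle of radius `s` that lies in `E`, measured as an angle. -/
def angularMeasure (E : Set ℂ) (s : ℝ) : ℝ :=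
  (volume.restrict (Ioo (-Real.pi) Real.pi)).real {θ | Complex.polarCoord.symm (s, θ) ∈ E}

theorem norm_polarCoord_symm_of_pos {s : ℝ} (hs : 0 < s) (θ : ℝ) :
    ‖Complex.polarCoord.symm (s, θ)‖ = s := by
  rw [Complex.norm_polarCoord_symm, abs_of_pos hs]

theorem arg_polarCoord_symm {s θ : ℝ} (hs : 0 < s) (hθ : θ ∈ Ioo (-Real.pi) Real.pi) :
    Complex.arg (Complex.polarCoord.symm (s, θ)) = θ := by
  rw [Complex.polarCoord_symm_apply, Complex.ofReal_cos, Complex.ofReal_sin]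
  exact Complex.arg_mul_cos_add_sin_mul_I hs ⟨hθ.1, hθ.2.le⟩

theorem integrableOn_and_setIntegral_norm_eq {ω : ℝ → ℝ} (hω : IntegrableOn ω (Ico (0:ℝ) 1))
    {E : Set ℂ} (hE : MeasurableSet E) (hEd : E ⊆ unitDisc) :
    IntegrableOn (fun s => s * ω s * angularMeasure E s) (Ioo (0:ℝ) 1) ∧
      ∫ u in E, ω ‖u‖ = ∫ s in Ioo (0:ℝ) 1, s * ω s * angularMeasure E s := by
  set g : ℝ → ℝ := (Ioo (0:ℝ) 1).indicator (fun s => s * ω s) with hg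
  set A : Measure ℝ := volume.restrict (Ioi (0:ℝ)) with hA
  set B : Measure ℝ := volume.restrict (Ioo (-Real.pi) Real.pi) with hB
  have hsymm : Measurable (fun p : ℝ × ℝ => Complex.polarCoord.symm p) := by
    simp only [Complex.polarCoord_symm_apply]
    fun_prop
  have hEp : MeasurableSet {p : ℝ × ℝ | Complex.polarCoord.symm p ∈ E} := hsymm hE
  have hsω : IntegrableOn (fun s => s * ω s) (Ioo (0:ℝ) 1) := by
    refine Integrable.bdd_mul (c := 1) (hω.mono_set Ioo_subset_Ico_self)
      (by fun_prop) ?_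
    filter_upwards [ae_restrict_mem measurableSet_Ioo] with s hs
    rw [Real.norm_eq_abs, abs_of_pos hs.1]
    exact hs.2.le
  have hgi : Integrable g A := (hsω.integrable_indicator measurableSet_Ioo).restrict
  have hF : Integrable ({p : ℝ × ℝ | Complex.polarCoord.symm p ∈ E}.indicator
      (fun p => g p.1)) (A.prod B) := (hgi.comp_fst B).indicator hEp
  have hinner : ∀ s, ∫ θ, {p : ℝ × ℝ | Complex.polarCoord.symm p ∈ E}.indicator
      (fun p => g p.1) (s, θ) ∂B = g s * angularMeasure E s := by
    intro s
    have : (fun θ => {p : ℝ × ℝ | Complex.polarCoord.symm p ∈ E}.indicator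
        (fun p => g p.1) (s, θ)) =
        {θ | Complex.polarCoord.symm (s, θ) ∈ E}.indicator (fun _ => g s) := by
      ext θ
      simp [indicator]
    have hm : MeasurableSet {θ | Complex.polarCoord.symm (s, θ) ∈ E} := measurable_prodMk_left hEp
    rw [this, integral_indicator hm, setIntegral_const, smul_eq_mul, mul_comm]
    rfl
  have hgm : (fun s => g s * angularMeasure E s) =
      (Ioo (0:ℝ) 1).indicator (fun s => s * ω s * angularMeasure E s) := by
    ext s
    by_cases hs : s ∈ Ioo (0:ℝ) 1 <;> simp [hg, hs]
  have hsub : Ioo (0:ℝ) 1 ∩ Ioi 0 = Ioo (0:ℝ) 1 := inter_eq_left.2 fun s hs => hs.1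
  constructor
  · have h := hF.integral_prod_left
    simp only [hinner] at h
    rw [hgm, integrable_indicator_iff measurableSet_Ioo, IntegrableOn, hA,
      Measure.restrict_restrict measurableSet_Ioo, hsub] at h
    exact h
  · rw [← integral_indicator hE, ← Complex.integral_comp_polarCoord_symm]
    have htarget : (volume : Measure (ℝ × ℝ)).restrict polarCoord.target = A.prod B := by
      rw [hA, hB, Measure.prod_restrict]
      rfl
    have hcongr : ∫ p in polarCoord.target,
        p.1 • E.indicator (fun u => ω ‖u‖) (Complex.polarCoord.symm p) =
        ∫ p in polarCoord.target, {p : ℝ × ℝ | Complex.polarCoord.symm p ∈ E}.indicator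
          (fun p => g p.1) p := by
      refine setIntegral_congr_fun polarCoord.open_target.measurableSet ?_
      rintro ⟨s, θ⟩ hp
      have hs : 0 < s := hp.1
      by_cases h : Complex.polarCoord.symm (s, θ) ∈ E
      · have hs1 : s < 1 := by
          have := hEd h
          rwa [unitDisc, mem_ofPred_eq, norm_polarCoord_symm_of_pos hs] at this
        simp only [indicator, h, hg, mem_ofPred_eq, if_true, mem_Ioo, hs, hs1, and_self, smul_eq_mul,
          norm_polarCoord_symm_of_pos hs]
      · simp only [indicator, h, mem_ofPred_eq, if_false, smul_zero]
    rw [hcongr, htarget, integral_prod _ hF]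
    simp only [hinner]
    rw [hgm, integral_indicator measurableSet_Ioo, hA, Measure.restrict_restrict measurableSet_Ioo,
      hsub]

theorem measurableSet_tent (z : ℂ) : MeasurableSet (Tent z) := by
  have h1 : MeasurableSet {u : ℂ | ‖u‖ < 1} := measurableSet_lt (by fun_prop) (by fun_prop)
  have h2 : MeasurableSet {u : ℂ | |Complex.arg u - Complex.arg z| < (1 - ‖z‖ / ‖u‖) / 2} :=
    measurableSet_lt (by simpa only [Real.norm_eq_abs] using
      (Complex.measurable_arg.sub_const (Complex.arg z)).norm) (by fun_prop)
  exact h1.inter ((MeasurableSet.const (z ∈ unitDisc)).inter h2)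

theorem measurableSet_cSq (z : ℂ) : MeasurableSet (CSq z) := by
  have h1 : MeasurableSet {u : ℂ | ‖z‖ ≤ ‖u‖} := measurableSet_le (by fun_prop) (by fun_prop)
  have h2 : MeasurableSet {u : ℂ | ‖u‖ < 1} := measurableSet_lt (by fun_prop) (by fun_prop)
  have hm : Measurable fun u : ℂ =>
      Complex.arg (z * Complex.exp (-(Complex.arg u : ℂ) * Complex.I)) := by
    have := Complex.measurable_arg
    fun_prop
  have h3 : MeasurableSet {u : ℂ |
      |Complex.arg (z * Complex.exp (-(Complex.arg u : ℂ) * Complex.I))| ≤ (1 - ‖z‖) / 2} :=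
    measurableSet_le (by simpa only [Real.norm_eq_abs] using hm.norm) (by fun_prop)
  exact h1.inter (h2.inter h3)

theorem tent_subset_unitDisc (z : ℂ) : Tent z ⊆ unitDisc := fun _ h => h.1

theorem cSq_subset_unitDisc (z : ℂ) : CSq z ⊆ unitDisc := fun _ h => h.2.1

theorem angularMeasure_nonneg (E : Set ℂ) (s : ℝ) : 0 ≤ angularMeasure E s :=
  measureReal_nonneg

theorem angularMeasure_eq_zero {E : Set ℂ} {s : ℝ}
    (h : ∀ θ ∈ Ioo (-Real.pi) Real.pi, Complex.polarCoord.symm (s, θ) ∉ E) :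
    angularMeasure E s = 0 := by
  rw [angularMeasure, measureReal_restrict_apply' measurableSet_Ioo]
  convert measureReal_empty
  ext θ
  simp only [mem_inter_iff, mem_ofPred_eq, mem_empty_iff_false, iff_false, not_and]
  exact fun h1 h2 => h θ h2 h1

theorem polarCoord_symm_mem_tent_iff {z : ℂ} (hz : ‖z‖ < 1) {s θ : ℝ} (hs : s ∈ Ioo (0:ℝ) 1)
    (hθ : θ ∈ Ioo (-Real.pi) Real.pi) :
    Complex.polarCoord.symm (s, θ) ∈ Tent z ↔ |θ - Complex.arg z| < (1 - ‖z‖ / s) / 2 := by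
  simp only [Tent, Gamma, unitDisc, mem_ofPred_eq, norm_polarCoord_symm_of_pos hs.1,
    arg_polarCoord_symm hs.1 hθ, hs.2, hz, true_and]

theorem angularMeasure_tent_eq_zero {z : ℂ} (hz : ‖z‖ < 1) {s : ℝ} (hs : s ∈ Ioo (0:ℝ) 1)
    (hsz : s ≤ ‖z‖) : angularMeasure (Tent z) s = 0 := by
  refine angularMeasure_eq_zero fun θ hθ h => ?_
  rw [polarCoord_symm_mem_tent_iff hz hs hθ] at h
  have h1 : 1 ≤ ‖z‖ / s := (one_le_div hs.1).2 hsz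
  linarith [abs_nonneg (θ - Complex.arg z)]

theorem angularMeasure_tent_le {z : ℂ} (hz : ‖z‖ < 1) {s : ℝ} (hs : s ∈ Ioo (0:ℝ) 1)
    (hsz : ‖z‖ ≤ s) : angularMeasure (Tent z) s ≤ 1 - ‖z‖ / s := by
  have h1 : ‖z‖ / s ≤ 1 := (div_le_one hs.1).2 hsz
  have hle : angularMeasure (Tent z) s ≤ volume.real
      (Icc (Complex.arg z - (1 - ‖z‖ / s) / 2) (Complex.arg z + (1 - ‖z‖ / s) / 2)) := by
    rw [angularMeasure, measureReal_restrict_apply' measurableSet_Ioo]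
    refine measureReal_mono ?_ (by simp)
    rintro θ ⟨h, hθ⟩
    have := abs_lt.1 ((polarCoord_symm_mem_tent_iff hz hs hθ).1 h)
    constructor <;> linarith
  rw [Real.volume_real_Icc_of_le (by linarith)] at hle
  linarith

theorem le_angularMeasure_tent {z : ℂ} (hz : ‖z‖ < 1) {s : ℝ} (hs : s ∈ Ioo (0:ℝ) 1)
    (hsz : ‖z‖ ≤ s) : (1 - ‖z‖ / s) / 2 ≤ angularMeasure (Tent z) s := by
  have h1 : ‖z‖ / s ≤ 1 := (div_le_one hs.1).2 hsz
  have h0 : 0 ≤ ‖z‖ / s := div_nonneg (norm_nonneg _) hs.1.le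
  have hpi := Real.pi_gt_three
  have harg := Complex.neg_pi_lt_arg z
  have harg' := Complex.arg_le_pi z
  obtain ⟨a, ha, ha', haα⟩ : ∃ a, -Real.pi ≤ a ∧ a + (1 - ‖z‖ / s) / 2 ≤ Real.pi ∧
      ∀ θ ∈ Ioo a (a + (1 - ‖z‖ / s) / 2), |θ - Complex.arg z| < (1 - ‖z‖ / s) / 2 := by
    rcases le_total (Complex.arg z) 0 with h | h
    · refine ⟨Complex.arg z, by linarith, by linarith, fun θ hθ => abs_lt.2 ⟨?_, ?_⟩⟩ <;>
        linarith [hθ.1, hθ.2]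
    · refine ⟨Complex.arg z - (1 - ‖z‖ / s) / 2, by linarith, by linarith,
        fun θ hθ => abs_lt.2 ⟨?_, ?_⟩⟩ <;> linarith [hθ.1, hθ.2]
  have hle : volume.real (Ioo a (a + (1 - ‖z‖ / s) / 2)) ≤ angularMeasure (Tent z) s := by
    rw [angularMeasure, measureReal_restrict_apply' measurableSet_Ioo]
    refine measureReal_mono (fun θ hθ => ?_)
      (measure_ne_top_of_subset inter_subset_right (by simp))
    have hθ' : θ ∈ Ioo (-Real.pi) Real.pi := ⟨ha.trans_lt hθ.1, hθ.2.trans_le ha'⟩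
    exact ⟨(polarCoord_symm_mem_tent_iff hz hs hθ').2 (haα θ hθ), hθ'⟩
  rwa [Real.volume_real_Ioo_of_le (by linarith), add_sub_cancel_left] at hle

theorem angularMeasure_cSq_eq_zero {z : ℂ} {s : ℝ} (hs : 0 < s) (hsz : s < ‖z‖) :
    angularMeasure (CSq z) s = 0 := by
  refine angularMeasure_eq_zero fun θ hθ h => ?_
  have := h.1
  rw [norm_polarCoord_symm_of_pos hs] at this
  linarith

theorem exists_arg_mul_exp_neg_eq {z : ℂ} (hz : z ≠ 0) (θ : ℝ) :
    ∃ k : ℤ, Complex.arg (z * Complex.exp (-(θ : ℂ) * Complex.I)) =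
      Complex.arg z - θ - k * (2 * Real.pi) := by
  have h : z * Complex.exp (-(θ : ℂ) * Complex.I) =
      (‖z‖ : ℂ) * Complex.exp (((Complex.arg z - θ : ℝ) : ℂ) * Complex.I) := by
    conv_lhs => rw [← Complex.norm_mul_exp_arg_mul_I z]
    rw [mul_assoc, ← Complex.exp_add]
    push_cast
    ring_nf
  refine ⟨toIocDiv Real.two_pi_pos (-Real.pi) (Complex.arg z - θ), ?_⟩
  rw [h, Complex.arg_real_mul _ (norm_pos_iff.2 hz), Complex.arg_exp_mul_I, toIocMod, zsmul_eq_mul]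

theorem angularMeasure_cSq_le {z : ℂ} (hz1 : ‖z‖ < 1) {s : ℝ} (hs : s ∈ Ioo (0:ℝ) 1) :
    angularMeasure (CSq z) s ≤ 7 * (1 - ‖z‖) := by
  have hpi := Real.pi_lt_d2
  have hpi0 := Real.pi_gt_three
  rcases eq_or_ne z 0 with rfl | hz
  · have h : angularMeasure (CSq 0) s ≤ volume.real (Ioo (-Real.pi) Real.pi) := by
      rw [angularMeasure, measureReal_restrict_apply' measurableSet_Ioo]
      exact measureReal_mono inter_subset_right (by simp)
    rw [Real.volume_real_Ioo_of_le (by linarith)] at h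
    rw [norm_zero]
    linarith
  set h := (1 - ‖z‖) / 2 with hh
  have hh0 : 0 ≤ h := by linarith
  have hle : angularMeasure (CSq z) s ≤ volume.real (⋃ k ∈ ({-1, 0, 1} : Finset ℤ),
      Icc (Complex.arg z - k * (2 * Real.pi) - h) (Complex.arg z - k * (2 * Real.pi) + h)) := by
    rw [angularMeasure, measureReal_restrict_apply' measurableSet_Ioo]
    refine measureReal_mono ?_ ?_
    · rintro θ ⟨hθE, hθ⟩
      have hθ' := hθE.2.2
      rw [arg_polarCoord_symm hs.1 hθ] at hθ'
      have hlt := Complex.neg_pi_lt_arg (z * Complex.exp (-(θ : ℂ) * Complex.I))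
      have hle := Complex.arg_le_pi (z * Complex.exp (-(θ : ℂ) * Complex.I))
      obtain ⟨k, hk⟩ := exists_arg_mul_exp_neg_eq hz θ
      rw [hk] at hθ' hlt hle
      have hlt' := Complex.neg_pi_lt_arg z
      have hle' := Complex.arg_le_pi z
      have hk1 : (k : ℝ) < 2 := by nlinarith [hθ.1, hθ.2]
      have hk2 : (-2 : ℝ) < k := by nlinarith [hθ.1, hθ.2]
      have hk1' : k < 2 := by exact_mod_cast hk1
      have hk2' : -2 < k := by exact_mod_cast hk2
      refine mem_iUnion₂.2 ⟨k, by simp only [Finset.mem_insert, Finset.mem_singleton]; omega, ?_⟩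
      have := abs_le.1 hθ'
      constructor <;> linarith
    · exact (measure_biUnion_lt_top (Finset.finite_toSet _) (by simp)).ne
  have hsum := hle.trans (measureReal_biUnion_finset_le _ _)
  have hvol : ∀ k : ℤ, volume.real (Icc (Complex.arg z - k * (2 * Real.pi) - h)
      (Complex.arg z - k * (2 * Real.pi) + h)) = 2 * h := by
    intro k
    rw [Real.volume_real_Icc_of_le (by linarith)]
    ring
  simp only [hvol, Finset.sum_const, nsmul_eq_mul] at hsum
  have hcard : (({-1, 0, 1} : Finset ℤ).card : ℝ) = 3 := by
    norm_num
  rw [hcard] at hsum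
  linarith

theorem tent_sdiff_singleton_subset_cSq {z : ℂ} (hz : ‖z‖ < 1) : Tent z \ {0} ⊆ CSq z := by
  rintro u ⟨⟨hu, -, h⟩, hu0⟩
  have hu0' : 0 < ‖u‖ := norm_pos_iff.2 hu0
  have hu1 : ‖u‖ < 1 := hu
  have hlt : ‖z‖ / ‖u‖ < 1 := by linarith [abs_nonneg (Complex.arg u - Complex.arg z)]
  have hzu : ‖z‖ ≤ ‖u‖ := ((div_lt_one hu0').1 hlt).le
  have hdiv : ‖z‖ ≤ ‖z‖ / ‖u‖ := le_div_self (norm_nonneg _) hu0' hu1.le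
  refine ⟨hzu, hu1, ?_⟩
  rcases eq_or_ne z 0 with rfl | hz0
  · simp
  obtain ⟨k, hk⟩ := exists_arg_mul_exp_neg_eq hz0 (Complex.arg u)
  have hlt' := Complex.neg_pi_lt_arg (z * Complex.exp (-(Complex.arg u : ℂ) * Complex.I))
  have hle' := Complex.arg_le_pi (z * Complex.exp (-(Complex.arg u : ℂ) * Complex.I))
  have habs := abs_lt.1 h
  have hpi := Real.pi_gt_three
  rw [hk] at hlt' hle' ⊢
  have hz0' := norm_nonneg z
  have hk1 : (k : ℝ) < 1 := by nlinarith
  have hk2 : (-1 : ℝ) < k := by nlinarith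
  have hk1' : k < 1 := by exact_mod_cast hk1
  have hk2' : -1 < k := by exact_mod_cast hk2
  obtain rfl : k = 0 := by omega
  rw [Int.cast_zero, zero_mul, sub_zero]
  exact abs_le.2 ⟨by linarith, by linarith⟩

theorem wInt_eq_setIntegral_Ioo (ω : ℝ → ℝ) {r : ℝ} (hr : r ≤ 1) :
    wInt ω r = ∫ s in Ioo r 1, ω s := by
  rw [wInt, intervalIntegral.integral_of_le hr, integral_Ioc_eq_integral_Ioo]

theorem IsRadialWeight.intervalIntegrable {ω : ℝ → ℝ} (hω : IsRadialWeight ω) {r : ℝ}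
    (hr : r ∈ Ico (0:ℝ) 1) : IntervalIntegrable ω volume r 1 := by
  rw [intervalIntegrable_iff_integrableOn_Ioo_of_le hr.2.le]
  exact hω.2.mono_set fun s hs => ⟨hr.1.trans hs.1.le, hs.2⟩

theorem IsRadialWeight.wInt_pos {ω : ℝ → ℝ} (hω : IsRadialWeight ω) {r : ℝ}
    (hr : r ∈ Ico (0:ℝ) 1) : 0 < wInt ω r :=
  intervalIntegral.intervalIntegral_pos_of_pos_on (hω.intervalIntegrable hr)
    (fun s hs => hω.1 s ⟨hr.1.trans hs.1.le, hs.2⟩) hr.2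

theorem IsRadialWeight.continuousOn_wInt {ω : ℝ → ℝ} (hω : IsRadialWeight ω) :
    ContinuousOn (wInt ω) (Icc 0 1) := by
  have h : IntegrableOn ω (uIcc 0 1) := by
    rw [uIcc_of_le zero_le_one, integrableOn_Icc_iff_integrableOn_Ico]
    exact hω.2
  have := intervalIntegral.continuousOn_primitive_interval_left h
  rwa [uIcc_of_le zero_le_one] at this

theorem IsRadialContinuousWeight.hasDerivAt_wInt_s4 {ω : ℝ → ℝ} (hω : IsRadialContinuousWeight ω)
    {r : ℝ} (hr : r ∈ Ioo (0:ℝ) 1) : HasDerivAt (wInt ω) (-ω r) r := by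
  have hc : ContinuousOn ω (Ioo 0 1) := hω.2.mono Ioo_subset_Ico_self
  exact intervalIntegral.integral_hasDerivAt_left
    (hω.1.intervalIntegrable (Ioo_subset_Ico_self hr))
    (hc.stronglyMeasurableAtFilter isOpen_Ioo r hr) (hc.continuousAt (isOpen_Ioo.mem_nhds hr))

/-- If the distortion function of `ω` is bounded below by a multiple of `1 - r`, then
`∫_r^1 ω` is doubling. -/
theorem IsRadialContinuousWeight.wInt_le_two_pow_mul {ω : ℝ → ℝ}
    (hω : IsRadialContinuousWeight ω) {K : ℕ}
    (hK : ∀ r ∈ Ico (0:ℝ) 1, (1 - r) * ω r ≤ K * wInt ω r) {r : ℝ} (hr : r ∈ Ico (0:ℝ) 1) :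
    wInt ω r ≤ 2 ^ K * wInt ω ((1 + r) / 2) := by
  have hderiv : ∀ x ∈ Ioo (0:ℝ) 1, HasDerivAt (fun x => wInt ω x / (1 - x) ^ K)
      ((-ω x * (1 - x) ^ K - wInt ω x * (K * (1 - x) ^ (K - 1) * (-1))) / ((1 - x) ^ K) ^ 2) x := by
    intro x hx
    have h1 : HasDerivAt (fun x : ℝ => 1 - x) (-1) x := (hasDerivAt_id x).const_sub 1
    exact (hω.hasDerivAt_wInt_s4 hx).div (h1.pow K) (pow_ne_zero _ (by linarith [hx.2]))
  have hmono : MonotoneOn (fun x => wInt ω x / (1 - x) ^ K) (Ico 0 1) := by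
    refine monotoneOn_of_deriv_nonneg (convex_Ico 0 1) ?_ ?_ ?_
    · refine (hω.1.continuousOn_wInt.mono Ico_subset_Icc_self).div (by fun_prop) fun x hx => ?_
      exact pow_ne_zero _ (by linarith [hx.2])
    · rw [interior_Ico]
      exact fun x hx => (hderiv x hx).differentiableAt.differentiableWithinAt
    · rw [interior_Ico]
      intro x hx
      rw [(hderiv x hx).deriv]
      refine div_nonneg ?_ (by positivity)
      have hx' := hK x (Ioo_subset_Ico_self hx)
      have h1x : 0 < 1 - x := by linarith [hx.2]
      rcases K with _ | n
      · have := hω.1.1 x (Ioo_subset_Ico_self hx)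
        rw [Nat.cast_zero, zero_mul] at hx'
        nlinarith
      · rw [Nat.add_sub_cancel, pow_succ]
        nlinarith [mul_nonneg (pow_pos h1x n).le (sub_nonneg.2 hx')]
  have hr' : (1 + r) / 2 ∈ Ico (0:ℝ) 1 := ⟨by linarith [hr.1], by linarith [hr.2]⟩
  have h := hmono hr hr' (by linarith [hr.2])
  have h1r : 0 < (1 - r) ^ K := pow_pos (by linarith [hr.2]) K
  have heq : (1 - (1 + r) / 2) ^ K = (1 - r) ^ K / 2 ^ K := by
    rw [← div_pow]
    ring
  simp only [heq] at h
  rw [div_div_eq_mul_div, div_le_div_iff_of_pos_right h1r] at h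
  linarith

theorem IsRegularWeight.exists_mul_le_mul_wInt {ω : ℝ → ℝ} (hω : IsRegularWeight ω) :
    ∃ K : ℕ, ∀ r ∈ Ico (0:ℝ) 1, (1 - r) * ω r ≤ K * wInt ω r := by
  obtain ⟨hω, c, C, hc, -, h⟩ := hω
  obtain ⟨K, hK⟩ := exists_nat_ge (1 / c)
  refine ⟨K, fun r hr => ?_⟩
  have h1 := (h r hr).1
  calc (1 - r) * ω r = 1 / c * (c * ((1 - r) * ω r)) := by field_simp
    _ ≤ 1 / c * wInt ω r := by gcongr
    _ ≤ K * wInt ω r := mul_le_mul_of_nonneg_right hK (hω.1.wInt_pos hr).le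

theorem IsRapidlyIncreasing.exists_mul_le_mul_wInt {ω : ℝ → ℝ} (hω : IsRapidlyIncreasing ω) :
    ∃ K : ℕ, ∀ r ∈ Ico (0:ℝ) 1, (1 - r) * ω r ≤ K * wInt ω r := by
  obtain ⟨hω, hlim⟩ := hω
  have hev := hlim.eventually_ge_atTop 1
  obtain ⟨l, hl, hl'⟩ := (mem_nhdsLT_iff_exists_Ioo_subset' (show (0:ℝ) < 1 by norm_num)).1 hev
  have hl1 : l < 1 := hl
  have hcont : ContinuousOn (fun r => (1 - r) * ω r / wInt ω r) (Icc 0 l) := by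
    have hsub : Icc 0 l ⊆ Ico (0:ℝ) 1 := fun x hx => ⟨hx.1, hx.2.trans_lt hl1⟩
    refine ContinuousOn.div (ContinuousOn.mul (by fun_prop) (hω.2.mono hsub))
      (hω.1.continuousOn_wInt.mono (hsub.trans Ico_subset_Icc_self)) fun x hx => ?_
    exact (hω.1.wInt_pos (hsub hx)).ne'
  obtain ⟨M, hM⟩ := isCompact_Icc.bddAbove_image hcont
  obtain ⟨K, hK⟩ := exists_nat_ge (max M 1)
  refine ⟨K, fun r hr => ?_⟩
  have hw := hω.1.wInt_pos hr
  have hr1 : 0 < 1 - r := by linarith [hr.2]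
  rcases le_or_gt r l with hrl | hrl
  · have h := hM (mem_image_of_mem _ ⟨hr.1, hrl⟩)
    rw [div_le_iff₀ hw] at h
    exact h.trans (mul_le_mul_of_nonneg_right ((le_max_left _ _).trans hK) hw.le)
  · have h : 1 ≤ wInt ω r / (ω r * (1 - r)) := hl' ⟨hrl, hr.2⟩
    rw [one_le_div (mul_pos (hω.1.1 r hr) hr1)] at h
    have hK1 : (1:ℝ) ≤ K := (le_max_right _ _).trans hK
    nlinarith

theorem setIntegral_tent_eq {ω : ℝ → ℝ} (hω : IsRadialWeight ω) {z : ℂ} (hz : ‖z‖ < 1) :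
    IntegrableOn (fun s => s * ω s * angularMeasure (Tent z) s) (Ioo ‖z‖ 1) ∧
      ∫ u in Tent z, ω ‖u‖ = ∫ s in Ioo ‖z‖ 1, s * ω s * angularMeasure (Tent z) s := by
  obtain ⟨h1, h2⟩ :=
    integrableOn_and_setIntegral_norm_eq hω.2 (measurableSet_tent z) (tent_subset_unitDisc z)
  have hsub : Ioo ‖z‖ 1 ⊆ Ioo 0 1 := Ioo_subset_Ioo_left (norm_nonneg z)
  refine ⟨h1.mono_set hsub, h2.trans ?_⟩
  refine setIntegral_eq_of_subset_of_forall_sdiff_eq_zero measurableSet_Ioo hsub fun s hs => ?_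
  rw [angularMeasure_tent_eq_zero hz hs.1 (not_lt.1 fun h => hs.2 ⟨h, hs.1.2⟩), mul_zero]

theorem IsRadialWeight.integrableOn_mul {ω : ℝ → ℝ} (hω : IsRadialWeight ω) {r C : ℝ}
    (hr : 0 ≤ r) {f : ℝ → ℝ} (hf : Measurable f) (hC : ∀ s ∈ Ioo r 1, |f s| ≤ C) :
    IntegrableOn (fun s => f s * ω s) (Ioo r 1) := by
  refine Integrable.bdd_mul (c := C) (hω.2.mono_set fun s hs => ⟨hr.trans hs.1.le, hs.2⟩)
    hf.aestronglyMeasurable ?_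
  filter_upwards [ae_restrict_mem measurableSet_Ioo] with s hs using hC s hs

theorem wStar_eq_setIntegral_Ioo (ω : ℝ → ℝ) {z : ℂ} (hz : ‖z‖ < 1) :
    wStar ω z = ∫ s in Ioo ‖z‖ 1, ω s * Real.log (s / ‖z‖) * s := by
  rw [wStar, intervalIntegral.integral_of_le hz.le, integral_Ioc_eq_integral_Ioo]

theorem one_sub_inv_bounds_log {x : ℝ} (h1 : 1 ≤ x) (h2 : x ≤ 2) :
    1 - x⁻¹ ≤ Real.log x ∧ Real.log x ≤ 2 * (1 - x⁻¹) := by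
  have hx : 0 < x := by linarith
  refine ⟨Real.one_sub_inv_le_log_of_pos hx, (Real.log_le_sub_one_of_pos hx).trans ?_⟩
  have : x - 1 = x * (1 - x⁻¹) := by field_simp
  rw [this]
  exact mul_le_mul_of_nonneg_right h2 (sub_nonneg.2 (inv_le_one_of_one_le₀ h1))

theorem setIntegral_tent_comparable_wStar {ω : ℝ → ℝ} (hω : IsRadialWeight ω) {z : ℂ}
    (hz2 : 1 / 2 ≤ ‖z‖) (hz : ‖z‖ < 1) :
    1 / 4 * wStar ω z ≤ (∫ u in Tent z, ω ‖u‖) ∧ (∫ u in Tent z, ω ‖u‖) ≤ wStar ω z := by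
  obtain ⟨hint, heq⟩ := setIntegral_tent_eq hω hz
  have hz0 : 0 < ‖z‖ := by linarith
  have hlog : ∀ s ∈ Ioo ‖z‖ 1, 1 - ‖z‖ / s ≤ Real.log (s / ‖z‖) ∧
      Real.log (s / ‖z‖) ≤ 2 * (1 - ‖z‖ / s) := by
    intro s hs
    have := one_sub_inv_bounds_log (x := s / ‖z‖) ((one_le_div hz0).2 hs.1.le)
      ((div_le_iff₀ hz0).2 (by linarith [hs.2]))
    rwa [inv_div] at this
  have hfrac : ∀ s ∈ Ioo ‖z‖ 1, 0 ≤ ‖z‖ / s ∧ ‖z‖ / s ≤ 1 := fun s hs =>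
    ⟨div_nonneg hz0.le (hz0.trans hs.1).le, (div_le_one (hz0.trans hs.1)).2 hs.1.le⟩
  have hint' : IntegrableOn (fun s => ω s * Real.log (s / ‖z‖) * s) (Ioo ‖z‖ 1) := by
    have h : IntegrableOn (fun s => Real.log (s / ‖z‖) * s * ω s) (Ioo ‖z‖ 1) := by
      refine hω.integrableOn_mul (C := 2) hz0.le (by fun_prop) fun s hs => ?_
      obtain ⟨h1, h2⟩ := hlog s hs
      obtain ⟨h3, h4⟩ := hfrac s hs
      rw [abs_of_nonneg (mul_nonneg (by linarith) (hz0.trans hs.1).le)]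
      nlinarith [hs.1, hs.2]
    refine h.congr_fun (fun s _ => ?_) measurableSet_Ioo
    ring
  rw [heq, wStar_eq_setIntegral_Ioo ω hz, ← integral_const_mul]
  have hsω : ∀ s ∈ Ioo ‖z‖ 1, 0 ≤ s * ω s := fun s hs =>
    mul_nonneg (hz0.trans hs.1).le (hω.1 s ⟨(hz0.trans hs.1).le, hs.2⟩).le
  constructor
  · refine setIntegral_mono_on (hint'.const_mul _) hint measurableSet_Ioo fun s hs => ?_
    have h := le_angularMeasure_tent hz ⟨hz0.trans hs.1, hs.2⟩ hs.1.le
    have h2 := (hlog s hs).2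
    have := mul_le_mul_of_nonneg_left
      (show 1 / 4 * Real.log (s / ‖z‖) ≤ angularMeasure (Tent z) s by linarith) (hsω s hs)
    linarith
  · refine setIntegral_mono_on hint hint' measurableSet_Ioo fun s hs => ?_
    have h := angularMeasure_tent_le hz ⟨hz0.trans hs.1, hs.2⟩ hs.1.le
    have := mul_le_mul_of_nonneg_left (h.trans (hlog s hs).1) (hsω s hs)
    linarith

theorem setIntegral_cSq_le {ω : ℝ → ℝ} (hω : IsRadialWeight ω) {z : ℂ} (hz : ‖z‖ < 1) :
    (∫ u in CSq z, ω ‖u‖) ≤ 7 * (1 - ‖z‖) * wInt ω ‖z‖ := by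
  obtain ⟨h1, h2⟩ :=
    integrableOn_and_setIntegral_norm_eq hω.2 (measurableSet_cSq z) (cSq_subset_unitDisc z)
  have hz0 := norm_nonneg z
  have hsub : Ico ‖z‖ 1 ∩ Ioi 0 ⊆ Ioo 0 1 := fun s hs => ⟨hs.2, hs.1.2⟩
  have hint : IntegrableOn (fun s => 7 * (1 - ‖z‖) * ω s) (Ico ‖z‖ 1) :=
    (hω.2.mono_set (Ico_subset_Ico_left hz0)).const_mul _
  have hC : 0 ≤ 7 * (1 - ‖z‖) := by linarith
  calc ∫ u in CSq z, ω ‖u‖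
      = ∫ s in Ico ‖z‖ 1 ∩ Ioi 0, s * ω s * angularMeasure (CSq z) s := by
        rw [h2]
        refine setIntegral_eq_of_subset_of_forall_sdiff_eq_zero measurableSet_Ioo hsub
          fun s hs => ?_
        rw [angularMeasure_cSq_eq_zero hs.1.1
          (not_le.1 fun h => hs.2 ⟨⟨h, hs.1.2⟩, hs.1.1⟩), mul_zero]
    _ ≤ ∫ s in Ico ‖z‖ 1 ∩ Ioi 0, 7 * (1 - ‖z‖) * ω s := by
        refine setIntegral_mono_on (h1.mono_set hsub) (hint.mono_set inter_subset_left)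
          (measurableSet_Ico.inter measurableSet_Ioi) fun s hs => ?_
        have hs' := hsub hs
        have hω0 := hω.1 s ⟨hs'.1.le, hs'.2⟩
        have h := angularMeasure_cSq_le hz hs'
        have hsω : s * ω s ≤ ω s := mul_le_of_le_one_left hω0.le hs'.2.le
        rw [mul_comm (7 * (1 - ‖z‖))]
        exact mul_le_mul hsω h (angularMeasure_nonneg _ _) hω0.le
    _ ≤ ∫ s in Ico ‖z‖ 1, 7 * (1 - ‖z‖) * ω s := by
        refine setIntegral_mono_set hint ?_ inter_subset_left.eventuallyLE
        filter_upwards [ae_restrict_mem measurableSet_Ico] with s hs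
        exact mul_nonneg hC (hω.1 s ⟨hz0.trans hs.1, hs.2⟩).le
    _ = 7 * (1 - ‖z‖) * wInt ω ‖z‖ := by
        rw [integral_const_mul, integral_Ico_eq_integral_Ioo, wInt_eq_setIntegral_Ioo ω hz.le]

theorem le_setIntegral_tent {ω : ℝ → ℝ} (hω : IsRadialWeight ω) {z : ℂ} (hz : ‖z‖ < 1) :
    (1 - ‖z‖) / 4 * wInt ω ((1 + ‖z‖) / 2) ≤ ∫ u in Tent z, ω ‖u‖ := by
  obtain ⟨hint, heq⟩ := setIntegral_tent_eq hω hz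
  have hz0 := norm_nonneg z
  have hpos : ∀ s ∈ Ioo ‖z‖ 1, 0 ≤ s * ω s := fun s hs =>
    mul_nonneg (hz0.trans hs.1.le) (hω.1 s ⟨hz0.trans hs.1.le, hs.2⟩).le
  have hsub : Ioo ((1 + ‖z‖) / 2) 1 ⊆ Ioo ‖z‖ 1 := Ioo_subset_Ioo_left (by linarith)
  rw [heq, wInt_eq_setIntegral_Ioo ω (by linarith), ← integral_const_mul]
  calc ∫ s in Ioo ((1 + ‖z‖) / 2) 1, (1 - ‖z‖) / 4 * ω s
      ≤ ∫ s in Ioo ((1 + ‖z‖) / 2) 1, s * ω s * angularMeasure (Tent z) s := by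
        refine setIntegral_mono_on ?_ (hint.mono_set hsub) measurableSet_Ioo fun s hs => ?_
        · exact (hω.2.mono_set fun s hs => ⟨by linarith [hs.1], hs.2⟩).const_mul _
        have hs0 : 0 < s := by linarith [hs.1]
        have h := le_angularMeasure_tent hz ⟨hs0, hs.2⟩ (hsub hs).1.le
        have h2 := mul_le_mul_of_nonneg_left h (hpos s (hsub hs))
        have h3 : s * ω s * ((1 - ‖z‖ / s) / 2) = (s - ‖z‖) / 2 * ω s := by field_simp
        rw [h3] at h2
        refine le_trans (mul_le_mul_of_nonneg_right ?_ (hω.1 s ⟨hs0.le, hs.2⟩).le) h2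
        linarith [hs.1]
    _ ≤ ∫ s in Ioo ‖z‖ 1, s * ω s * angularMeasure (Tent z) s := by
        refine setIntegral_mono_set hint ?_ hsub.eventuallyLE
        filter_upwards [ae_restrict_mem measurableSet_Ioo] with s hs
        exact mul_nonneg (hpos s hs) (angularMeasure_nonneg _ _)

theorem setIntegral_tent_le_cSq {ω : ℝ → ℝ} (hω : IsRadialWeight ω) {z : ℂ} (hz : ‖z‖ < 1) :
    (∫ u in Tent z, ω ‖u‖) ≤ ∫ u in CSq z, ω ‖u‖ := by
  obtain ⟨h1, h2⟩ :=
    integrableOn_and_setIntegral_norm_eq hω.2 (measurableSet_tent z) (tent_subset_unitDisc z)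
  obtain ⟨h3, h4⟩ :=
    integrableOn_and_setIntegral_norm_eq hω.2 (measurableSet_cSq z) (cSq_subset_unitDisc z)
  rw [h2, h4]
  refine setIntegral_mono_on h1 h3 measurableSet_Ioo fun s hs => ?_
  refine mul_le_mul_of_nonneg_left ?_ (mul_nonneg hs.1.le (hω.1 s ⟨hs.1.le, hs.2⟩).le)
  refine measureReal_mono (fun θ hθ => tent_sdiff_singleton_subset_cSq hz ⟨hθ, fun h0 => ?_⟩)
    (measure_ne_top _ _)
  have h := norm_polarCoord_symm_of_pos hs.1 θ
  rw [mem_singleton_iff.1 h0, norm_zero] at h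
  exact hs.1.ne h

theorem stmt4 (ω : ℝ → ℝ) :
    (IsRadialWeight ω → ∃ c C : ℝ, 0 < c ∧ 0 < C ∧
      ∀ z : ℂ, 1 / 2 ≤ ‖z‖ → ‖z‖ < 1 →
        c * wStar ω z ≤ (∫ u in Tent z, ω ‖u‖) ∧
          (∫ u in Tent z, ω ‖u‖) ≤ C * wStar ω z) ∧
    ((IsRegularWeight ω ∨ IsRapidlyIncreasing ω) → ∃ c C : ℝ, 0 < c ∧ 0 < C ∧
      ∀ z ∈ unitDisc,
        c * (∫ u in CSq z, ω ‖u‖) ≤ (∫ u in Tent z, ω ‖u‖) ∧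
          (∫ u in Tent z, ω ‖u‖) ≤ C * (∫ u in CSq z, ω ‖u‖)) := by
  constructor
  · exact fun hω => ⟨1 / 4, 1, by norm_num, one_pos, fun z hz2 hz => by
      simpa only [one_mul] using setIntegral_tent_comparable_wStar hω hz2 hz⟩
  · intro h
    have hω : IsRadialContinuousWeight ω := h.elim (fun h => h.1) fun h => h.1
    obtain ⟨K, hK⟩ := h.elim IsRegularWeight.exists_mul_le_mul_wInt
      IsRapidlyIncreasing.exists_mul_le_mul_wInt
    refine ⟨1 / (28 * 2 ^ K), 1, by positivity, one_pos, fun z hz => ?_⟩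
    have hz1 : ‖z‖ < 1 := hz
    refine ⟨?_, by simpa only [one_mul] using setIntegral_tent_le_cSq hω.1 hz1⟩
    have hdoubling := hω.wInt_le_two_pow_mul hK ⟨norm_nonneg z, hz1⟩
    calc 1 / (28 * 2 ^ K) * (∫ u in CSq z, ω ‖u‖)
        ≤ 1 / (28 * 2 ^ K) *
          (7 * (1 - ‖z‖) * (2 ^ K * wInt ω ((1 + ‖z‖) / 2))) := by
          refine mul_le_mul_of_nonneg_left ((setIntegral_cSq_le hω.1 hz1).trans ?_) (by positivity)
          exact mul_le_mul_of_nonneg_left hdoubling (by linarith)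
      _ = (1 - ‖z‖) / 4 * wInt ω ((1 + ‖z‖) / 2) := by
          field_simp
          ring
      _ ≤ ∫ u in Tent z, ω ‖u‖ := le_setIntegral_tent hω.1 hz1
end
end
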